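/- arXiv:1702.08011 — 2 statements merged into one kernel-verified Lean document; each statement's English description precedes it below -/
import Mathlib

section
/- Let B be a commutative monoid. The quasi-shuffle product on the free module spanned by finite sequences over B, defined recursively by ∅*α = α*∅ = α and (a,α)*(b,β) = (a, α*(b,β)) + (b, (a,α)*β) + (a+b, α*β), is associative. -/
/-- The quasi-shuffle product of two words over a commutative monoid `B`,
valued in the free `k`-module on words:
`∅*α = α*∅ = α` and `(a,α)*(b,β) = (a, α*(b,β)) + (b, (a,α)*β) + (a+b, α*β)`. -/
noncomputable def qs (k : Type*) [CommRing k] {B : Type*} [AddCommMonoid B] :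
    List B → List B → (List B →₀ k)
  | [], β => Finsupp.single β 1
  | α, [] => Finsupp.single α 1
  | a :: α, b :: β =>
      Finsupp.mapDomain (List.cons a) (qs k α (b :: β)) +
      Finsupp.mapDomain (List.cons b) (qs k (a :: α) β) +
      Finsupp.mapDomain (List.cons (a + b)) (qs k α β)
  termination_by α β => α.length + β.length

/-- The bilinear extension of the quasi-shuffle product to the free module. -/
noncomputable def qsMul {k : Type*} [CommRing k] {B : Type*} [AddCommMonoid B]
    (f g : List B →₀ k) : List B →₀ k :=
  f.sum fun α c => g.sum fun β d => (c * d) • qs k α β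

namespace QSAux

theorem ind (k : Type*) [CommRing k] {B : Type*} {P : (List B →₀ k) → Prop} (h0 : P 0) (hadd : ∀ x y, P x → P y → P (x + y))
    (hs : ∀ (c : k) x, P x → P (c • x)) (hw : ∀ α, P (Finsupp.single α 1)) (x) : P x := by
  induction x using Finsupp.induction_linear with
  | zero => exact h0
  | add x y hx hy => exact hadd _ _ hx hy
  | single a c =>
    have := hs c _ (hw a)
    simpa using this


variable (k : Type*) [CommRing k] {B : Type*} [AddCommMonoid B]

noncomputable def M : (List B →₀ k) →ₗ[k] (List B →₀ k) →ₗ[k] (List B →₀ k) :=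
  Finsupp.lsum k fun α => LinearMap.toSpanSingleton k _
    (Finsupp.lsum k fun β => LinearMap.toSpanSingleton k _ (qs k α β))

noncomputable def C (a : B) : (List B →₀ k) →ₗ[k] (List B →₀ k) :=
  Finsupp.lmapDomain k k (List.cons a)

noncomputable def w (α : List B) : List B →₀ k := Finsupp.single α 1

theorem qsMul_eq (f g : List B →₀ k) : qsMul f g = M k f g := by
  simp only [qsMul, M, Finsupp.lsum_apply, Finsupp.sum, LinearMap.sum_apply,
    LinearMap.toSpanSingleton_apply, LinearMap.smul_apply, Finset.smul_sum, mul_smul]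

theorem M_w (α β : List B) : M k (w k α) (w k β) = qs k α β := by
  simp [M, w]

theorem C_w (a : B) (α : List B) : C k a (w k α) = w k (a :: α) := by
  simp [C, w, Finsupp.mapDomain_single]

theorem nil_M_w (β : List B) : M k (w k []) (w k β) = w k β := by
  rw [M_w, qs, w]

theorem M_w_nil (α : List B) : M k (w k α) (w k []) = w k α := by
  rw [M_w]; cases α <;> simp [qs, w]

theorem nil_M (x : List B →₀ k) : M k (w k []) x = x := by
  induction x using ind k with
  | h0 => simp
  | hadd x y hx hy => simp [hx, hy]
  | hs c x hx => simp [hx]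
  | hw α => exact nil_M_w k α

theorem M_nil (x : List B →₀ k) : M k x (w k []) = x := by
  induction x using ind k with
  | h0 => simp
  | hadd x y hx hy => simp [hx, hy]
  | hs c x hx => simp [hx]
  | hw α => exact M_w_nil k α

theorem M_C (a b : B) (x y : List B →₀ k) :
    M k (C k a x) (C k b y) =
      C k a (M k x (C k b y)) + C k b (M k (C k a x) y) + C k (a + b) (M k x y) := by
  induction x using ind k with
  | h0 => simp
  | hadd x y hx hy => simp only [map_add, LinearMap.add_apply, hx, hy]; abel
  | hs c x hx => simp only [map_smul, LinearMap.smul_apply, hx, smul_add]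
  | hw α =>
    induction y using ind k with
    | h0 => simp
    | hadd x y hx hy => simp only [map_add, hx, hy]; abel
    | hs c x hx => simp only [map_smul, hx, smul_add]
    | hw β =>
      change M k (C k a (w k α)) (C k b (w k β)) = C k a (M k (w k α) (C k b (w k β)))
        + C k b (M k (C k a (w k α)) (w k β)) + C k (a + b) (M k (w k α) (w k β))
      simp only [C_w, M_w]
      rw [qs]; rfl

theorem assoc_w (n : ℕ) : ∀ α β γ : List B, α.length + β.length + γ.length ≤ n →
    M k (M k (w k α) (w k β)) (w k γ) = M k (w k α) (M k (w k β) (w k γ)) := by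
  induction n with
  | zero =>
    intro α β γ h
    have : α = [] := List.length_eq_zero_iff.1 (by omega)
    subst this
    simp [nil_M]
  | succ n ih =>
    intro α β γ h
    rcases α with _ | ⟨a, α⟩
    · simp [nil_M]
    rcases β with _ | ⟨b, β⟩
    · simp [nil_M, M_nil]
    rcases γ with _ | ⟨c, γ⟩
    · simp [M_nil]
    simp only [List.length_cons] at h
    have h1 := ih α (b :: β) (c :: γ) (by simp only [List.length_cons]; omega)
    have h2 := ih (a :: α) β (c :: γ) (by simp only [List.length_cons]; omega)
    have h3 := ih (a :: α) (b :: β) γ (by simp only [List.length_cons]; omega)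
    have h4 := ih α β (c :: γ) (by simp only [List.length_cons]; omega)
    have h5 := ih α (b :: β) γ (by simp only [List.length_cons]; omega)
    have h6 := ih (a :: α) β γ (by simp only [List.length_cons]; omega)
    have h7 := ih α β γ (by omega)
    simp only [← C_w] at *
    generalize w k α = x at *
    generalize w k β = y at *
    generalize w k γ = z at *
    have L : M k (M k (C k a x) (C k b y)) (C k c z) =
        C k a (M k (M k x (C k b y)) (C k c z)) + C k b (M k (M k (C k a x) y) (C k c z))
        + C k (a + b) (M k (M k x y) (C k c z)) + C k c (M k (M k (C k a x) (C k b y)) z)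
        + C k (a + c) (M k (M k x (C k b y)) z) + C k (b + c) (M k (M k (C k a x) y) z)
        + C k (a + b + c) (M k (M k x y) z) := by
      rw [M_C k a b x y]
      simp only [map_add, LinearMap.add_apply]
      rw [M_C k a c, M_C k b c, M_C k (a + b) c]
      abel
    have R : M k (C k a x) (M k (C k b y) (C k c z)) =
        C k a (M k x (M k (C k b y) (C k c z))) + C k b (M k (C k a x) (M k y (C k c z)))
        + C k (a + b) (M k x (M k y (C k c z))) + C k c (M k (C k a x) (M k (C k b y) z))
        + C k (a + c) (M k x (M k (C k b y) z)) + C k (b + c) (M k (C k a x) (M k y z))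
        + C k (a + b + c) (M k x (M k y z)) := by
      rw [M_C k b c y z]
      simp only [map_add]
      rw [M_C k a b, M_C k a c, M_C k a (b + c), add_assoc a b c]
      abel
    rw [L, R, h1, h2, h3, h4, h5, h6, h7]

theorem assoc (x y z : List B →₀ k) : M k (M k x y) z = M k x (M k y z) := by
  induction x using ind k with
  | h0 => simp
  | hadd x y hx hy => simp only [map_add, LinearMap.add_apply, hx, hy]
  | hs c x hx => simp only [map_smul, LinearMap.smul_apply, hx]
  | hw α =>
    induction y using ind k with
    | h0 => simp
    | hadd x y hx hy => simp only [map_add, LinearMap.add_apply, hx, hy]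
    | hs c x hx => simp only [map_smul, LinearMap.smul_apply, hx]
    | hw β =>
      induction z using ind k with
      | h0 => simp
      | hadd x y hx hy => simp only [map_add, hx, hy]
      | hs c x hx => simp only [map_smul, hx]
      | hw γ => exact assoc_w k _ α β γ le_rfl

end QSAux

/-- The quasi-shuffle product is associative. -/
theorem stmt_6 (k : Type*) [CommRing k] {B : Type*} [AddCommMonoid B]
    (f g h : List B →₀ k) : qsMul (qsMul f g) h = qsMul f (qsMul g h) := by
  simp only [QSAux.qsMul_eq, QSAux.assoc]
end

section
/- Define φ on the quasi-shuffle algebra of words over Ñ∖{0} by φ(α) = (−1)^{ℓ_ε(α)} ᾱ if the first entry of α is a positive integer (or α is empty), and φ(α) = 0 if the first entry is ε, where ℓ_ε(α) is the number of ε entries and ᾱ deletes all ε entries. Then for every positive integer a and all words α, β over Ñ∖{0}: φ((a, α*β)) = (−1)^{ℓ_ε(α)+ℓ_ε(β)} (a, ᾱ*β̄), where (a,γ) prepends a to each word occurring in γ. -/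
/-- The map `φ` on words over the monoid `Ñ∖{0}` (identified with `(ℕ,+)` via
the isomorphism `θ` sending `ε` to `0`, so that `ε`-entries are `0`-entries):
`φ(α) = (−1)^{ℓ_ε(α)} ᾱ` if `α` is empty or its first entry is a positive
integer, and `φ(α) = 0` if the first entry is `ε`; here `ℓ_ε(α)` is the number
of `ε`-entries and `ᾱ` deletes all `ε`-entries (yielding a word over `ℙ`). -/
noncomputable def phi (k : Type*) [CommRing k] (α : List ℕ) : List ℕ →₀ k :=
  if α.head? = some 0 then 0
  else (-1 : k) ^ (α.count 0) • Finsupp.single (α.filter (· ≠ 0)) 1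

noncomputable def psiAux (k : Type*) [CommRing k] : (List ℕ →₀ k) →ₗ[k] (List ℕ →₀ k) :=
  Finsupp.linearCombination k fun γ : List ℕ =>
    (-1 : k) ^ (γ.count 0) • Finsupp.single (γ.filter (· ≠ 0)) (1 : k)

theorem psiAux_single (k : Type*) [CommRing k] (γ : List ℕ) (c : k) :
    psiAux k (Finsupp.single γ c) =
      c • (-1 : k) ^ (γ.count 0) • Finsupp.single (γ.filter (· ≠ 0)) (1 : k) := by
  rw [psiAux, Finsupp.linearCombination_single]

theorem psiAux_cons_zero (k : Type*) [CommRing k] (x : List ℕ →₀ k) :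
    psiAux k (Finsupp.mapDomain (List.cons 0) x) = - psiAux k x := by
  induction x using Finsupp.induction_linear with
  | zero => simp
  | add f g hf hg => rw [Finsupp.mapDomain_add, map_add, hf, hg, map_add, neg_add]
  | single γ c =>
    rw [Finsupp.mapDomain_single, psiAux_single, psiAux_single]
    simp [pow_succ]

theorem psiAux_cons_pos (k : Type*) [CommRing k] (a : ℕ) (ha : a ≠ 0) (x : List ℕ →₀ k) :
    psiAux k (Finsupp.mapDomain (List.cons a) x) =
      Finsupp.mapDomain (List.cons a) (psiAux k x) := by
  induction x using Finsupp.induction_linear with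
  | zero => simp
  | add f g hf hg =>
    rw [Finsupp.mapDomain_add, map_add, hf, hg, map_add, Finsupp.mapDomain_add]
  | single γ c =>
    rw [Finsupp.mapDomain_single, psiAux_single, psiAux_single, Finsupp.mapDomain_smul,
      Finsupp.mapDomain_smul, Finsupp.mapDomain_single]
    simp [ha]

theorem qs_nil_left (k : Type*) [CommRing k] (β : List ℕ) :
    qs k [] β = Finsupp.single β 1 := by
  rw [qs]

theorem qs_nil_right (k : Type*) [CommRing k] (α : List ℕ) :
    qs k α [] = Finsupp.single α 1 := by
  cases α with
  | nil => rw [qs]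
  | cons a α => rw [qs]; simp

theorem psiAux_qs (k : Type*) [CommRing k] : ∀ (n : ℕ) (α β : List ℕ),
    α.length + β.length = n → psiAux k (qs k α β) =
    (-1 : k) ^ (α.count 0 + β.count 0) •
        (qs k (α.filter (· ≠ 0)) (β.filter (· ≠ 0))) := by
  intro n
  induction n using Nat.strong_induction_on with
  | _ n ih =>
  intro α β hn
  match α, β with
  | [], β => rw [qs_nil_left, psiAux_single, List.filter_nil, qs_nil_left]; simp
  | α, [] => rw [qs_nil_right, psiAux_single, List.filter_nil, qs_nil_right]; simp
  | a :: α, b :: β =>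
    simp only [List.length_cons] at hn
    have h1 := ih _ (by simp; omega) α (b :: β) rfl
    have h2 := ih _ (by simp; omega) (a :: α) β rfl
    have h3 := ih _ (by omega) α β rfl
    rw [qs, map_add, map_add]
    by_cases ha : a = 0 <;> by_cases hb : b = 0
    · subst ha hb
      rw [add_zero, psiAux_cons_zero, psiAux_cons_zero, psiAux_cons_zero, h1, h2, h3]
      simp only [List.count_cons_self, List.filter_cons, ne_eq, not_true_eq_false,
        decide_false, Bool.false_eq_true, if_false]
      module
    · subst ha
      have e : ∀ l : List ℕ, (b :: l).count 0 = l.count 0 := fun l => by simp [hb]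
      rw [zero_add, psiAux_cons_zero, psiAux_cons_pos k b hb, psiAux_cons_pos k b hb, h1, h2, h3]
      simp only [List.count_cons_self, e, List.filter_cons, ne_eq, not_true_eq_false, hb,
        decide_false, Bool.false_eq_true, if_false, not_false_eq_true, decide_true, if_true,
        Finsupp.mapDomain_smul]
      module
    · subst hb
      have e : ∀ l : List ℕ, (a :: l).count 0 = l.count 0 := fun l => by simp [ha]
      rw [add_zero, psiAux_cons_zero, psiAux_cons_pos k a ha, psiAux_cons_pos k a ha, h1, h2, h3]
      simp only [List.count_cons_self, e, List.filter_cons, ne_eq, not_true_eq_false, ha,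
        decide_false, Bool.false_eq_true, if_false, not_false_eq_true, decide_true, if_true,
        Finsupp.mapDomain_smul]
      module
    · have e : ∀ l : List ℕ, (a :: l).count 0 = l.count 0 := fun l => by simp [ha]
      have e' : ∀ l : List ℕ, (b :: l).count 0 = l.count 0 := fun l => by simp [hb]
      rw [psiAux_cons_pos k a ha, psiAux_cons_pos k b hb, psiAux_cons_pos k (a + b) (by omega),
        h1, h2, h3]
      simp only [e, e', List.filter_cons, ne_eq, ha, hb,
        not_false_eq_true, decide_true, if_true, Finsupp.mapDomain_smul]
      rw [qs, smul_add, smul_add]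

/-- For every positive integer `a` and all words `α, β` over `Ñ∖{0}`:
`φ((a, α*β)) = (−1)^{ℓ_ε(α)+ℓ_ε(β)} (a, ᾱ*β̄)`, where `(a,γ)` prepends `a`
to each word occurring in `γ`. -/
theorem stmt_17 (k : Type*) [CommRing k] (a : ℕ) (ha : 0 < a) (α β : List ℕ) :
    ((qs k α β).sum fun γ c => c • phi k (a :: γ)) =
    (-1 : k) ^ (α.count 0 + β.count 0) •
      Finsupp.mapDomain (List.cons a)
        (qs k (α.filter (· ≠ 0)) (β.filter (· ≠ 0))) := by
  have key : ((qs k α β).sum fun γ c => c • phi k (a :: γ)) =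
      psiAux k (Finsupp.mapDomain (List.cons a) (qs k α β)) := by
    rw [psiAux, Finsupp.linearCombination_mapDomain, Finsupp.linearCombination_apply]
    refine Finsupp.sum_congr fun γ _ => ?_
    simp [phi, ha.ne']
  rw [key, psiAux_cons_pos k a ha.ne', psiAux_qs k _ α β rfl, Finsupp.mapDomain_smul]
end
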